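/- Let k ∈ {4, 5, 6} and let C be a Type II ℤ_{2k}-code of length 72 with d_E(C) = 16k (i.e., C is extremal). Then the Construction A lattice A_{2k}(C) = (1/√(2k))·{x ∈ ℤ^{72} : (x mod 2k) ∈ C} is a 72-dimensional extremal even unimodular lattice, i.e., an even unimodular lattice of minimum norm 8. -/

import Mathlib

open scoped BigOperators

/-- Euclidean weight of a word over `ℤ/mℤ`. -/
def euclWt {m : ℕ} {ι : Type*} [Fintype ι] (x : ι → ZMod m) : ℕ :=
  ∑ i, min ((x i).val ^ 2) ((m - (x i).val) ^ 2)

/-- The dual code under the standard inner product. -/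
def dualCode {m : ℕ} {ι : Type*} [Fintype ι]
    (C : Submodule (ZMod m) (ι → ZMod m)) : Set (ι → ZMod m) :=
  {x | ∀ y ∈ C, ∑ i, x i * y i = 0}

/-- A code is self-dual if it coincides with its dual code. -/
def IsSelfDualCode {m : ℕ} {ι : Type*} [Fintype ι]
    (C : Submodule (ZMod m) (ι → ZMod m)) : Prop :=
  (C : Set (ι → ZMod m)) = dualCode C

/-- A Type II `ℤ_{2k}`-code: self-dual with all Euclidean weights divisible by `4k`. -/
def IsTypeII (k : ℕ) {ι : Type*} [Fintype ι]
    (C : Submodule (ZMod (2 * k)) (ι → ZMod (2 * k))) : Prop :=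
  IsSelfDualCode C ∧ ∀ c ∈ C, 4 * k ∣ euclWt c

/-- The minimum Euclidean weight of a code. -/
noncomputable def minEuclWt {m : ℕ} {ι : Type*} [Fintype ι]
    (C : Submodule (ZMod m) (ι → ZMod m)) : ℕ :=
  sInf {w | ∃ c ∈ C, c ≠ 0 ∧ euclWt c = w}

/-- Standard inner product on `ι → ℝ`. -/
def ip {ι : Type*} [Fintype ι] (x y : ι → ℝ) : ℝ := ∑ i, x i * y i

/-- A lattice: a discrete `ℤ`-submodule of `ℝ^ι` spanning it over `ℝ`. -/
def IsLatticeIn {ι : Type*} [Fintype ι] (L : Submodule ℤ (ι → ℝ)) : Prop :=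
  DiscreteTopology L ∧ Submodule.span ℝ (L : Set (ι → ℝ)) = ⊤

/-- The dual lattice. -/
def dualLattice {ι : Type*} [Fintype ι] (L : Submodule ℤ (ι → ℝ)) : Set (ι → ℝ) :=
  {x | ∀ y ∈ L, ∃ z : ℤ, ip x y = (z : ℝ)}

/-- A lattice is unimodular if it equals its dual. -/
def IsUnimodularLattice {ι : Type*} [Fintype ι] (L : Submodule ℤ (ι → ℝ)) : Prop :=
  (L : Set (ι → ℝ)) = dualLattice L

/-- A lattice is even if every vector has even integral norm. -/
def IsEvenLattice {ι : Type*} [Fintype ι] (L : Submodule ℤ (ι → ℝ)) : Prop :=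
  ∀ x ∈ L, ∃ z : ℤ, ip x x = 2 * (z : ℝ)

/-- `r` is the minimum norm of the lattice `L`. -/
def HasMinNorm {ι : Type*} [Fintype ι] (L : Submodule ℤ (ι → ℝ)) (r : ℝ) : Prop :=
  IsLeast {t : ℝ | ∃ x ∈ L, x ≠ 0 ∧ ip x x = t} r

/-- Construction A: the set `(1/√m)·{x ∈ ℤ^ι : (x mod m) ∈ C}`. -/
def constructionA (m : ℕ) {ι : Type*} [Fintype ι] (C : Set (ι → ZMod m)) :
    Set (ι → ℝ) :=
  {v | ∃ x : ι → ℤ, (fun i => (x i : ZMod m)) ∈ C ∧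
    v = fun i => (x i : ℝ) / Real.sqrt m}

/-- A negacirculant matrix. -/
def IsNegacirculant {m : ℕ} {R : Type*} [CommRing R] (A : Matrix (Fin m) (Fin m) R) : Prop :=
  ∃ r : Fin m → R, ∀ i j : Fin m,
    A i j = if h : (i : ℕ) ≤ (j : ℕ) then r ⟨(j : ℕ) - (i : ℕ), by have := j.isLt; omega⟩
      else - r ⟨m + (j : ℕ) - (i : ℕ), by have := i.isLt; have := j.isLt; omega⟩

section Auxiliary

variable {m : ℕ} {ι : Type*} [Fintype ι]

/-- Construction A of a linear code, as a `ℤ`-submodule. -/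
def constructionALattice (C : Submodule (ZMod m) (ι → ZMod m)) : Submodule ℤ (ι → ℝ) where
  carrier := constructionA m (C : Set (ι → ZMod m))
  zero_mem' := ⟨0, by simp [← Pi.zero_def], by ext; simp⟩
  add_mem' := by
    rintro _ _ ⟨x, hx, rfl⟩ ⟨y, hy, rfl⟩
    refine ⟨x + y, ?_, by ext; simp [add_div]⟩
    rw [SetLike.mem_coe]
    convert C.add_mem hx hy using 1
    ext; simp
  smul_mem' := by
    rintro a _ ⟨x, hx, rfl⟩
    refine ⟨a • x, ?_, by ext; simp [mul_div_assoc]⟩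
    rw [SetLike.mem_coe]
    convert C.smul_mem (a : ZMod m) hx using 1
    ext; simp

theorem ip_div_sqrt (x y : ι → ℤ) :
    ip (fun i => (x i : ℝ) / Real.sqrt m) (fun i => (y i : ℝ) / Real.sqrt m) =
      ((∑ i, x i * y i : ℤ) : ℝ) / m := by
  simp only [ip, div_mul_div_comm, Real.mul_self_sqrt (Nat.cast_nonneg m)]
  push_cast
  rw [Finset.sum_div]

theorem single_sqrt_mem_constructionALattice [DecidableEq ι]
    (C : Submodule (ZMod m) (ι → ZMod m)) (i : ι) :
    Pi.single i (Real.sqrt m) ∈ constructionALattice C := by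
  refine ⟨Pi.single i (m : ℤ), ?_, ?_⟩
  · rw [SetLike.mem_coe]
    convert C.zero_mem using 1
    ext j
    rcases eq_or_ne j i with rfl | h <;> simp [*]
  · ext j
    rcases eq_or_ne j i with rfl | h <;> simp [*]

theorem isLatticeIn_constructionALattice [NeZero m] (C : Submodule (ZMod m) (ι → ZMod m)) :
    IsLatticeIn (constructionALattice C) := by
  classical
  have hm : 0 < Real.sqrt m := Real.sqrt_pos.2 (Nat.cast_pos.2 (NeZero.pos m))
  refine ⟨DiscreteTopology.of_forall_le_dist (inv_pos.2 hm) ?_, ?_⟩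
  · rintro ⟨_, x, _, rfl⟩ ⟨_, y, _, rfl⟩ hne
    obtain ⟨i, hi⟩ : ∃ i, x i ≠ y i := by
      by_contra! h
      exact hne (by simp [h])
    refine le_trans ?_ (dist_le_pi_dist _ _ i)
    rw [Real.dist_eq, ← sub_div, abs_div, abs_of_pos hm, inv_eq_one_div]
    gcongr
    exact_mod_cast Int.one_le_abs (sub_ne_zero.2 hi)
  · rw [Submodule.eq_top_iff']
    intro v
    rw [pi_eq_sum_univ' v]
    refine Submodule.sum_mem _ fun i _ => ?_
    convert Submodule.smul_mem _ (v i / Real.sqrt m)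
      (Submodule.subset_span (single_sqrt_mem_constructionALattice C i)) using 1
    ext j
    rcases eq_or_ne j i with rfl | h
    · simp [hm.ne']
    · simp [h]

theorem isUnimodularLattice_constructionALattice [NeZero m]
    {C : Submodule (ZMod m) (ι → ZMod m)} (hC : IsSelfDualCode C) :
    IsUnimodularLattice (constructionALattice C) := by
  classical
  have hm0 : (m : ℝ) ≠ 0 := Nat.cast_ne_zero.2 (NeZero.ne m)
  have hm : Real.sqrt m ≠ 0 := (Real.sqrt_pos.2 (Nat.cast_pos.2 (NeZero.pos m))).ne'
  have hmem (x : ι → ZMod m) : x ∈ C ↔ ∀ y ∈ C, ∑ i, x i * y i = 0 := Set.ext_iff.1 hC x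
  apply Set.Subset.antisymm
  · rintro _ ⟨x, hx, rfl⟩ _ ⟨y, hy, rfl⟩
    obtain ⟨z, hz⟩ : (m : ℤ) ∣ ∑ i, x i * y i := by
      rw [← ZMod.intCast_zmod_eq_zero_iff_dvd]
      simpa using (hmem _).1 hx _ hy
    refine ⟨z, ?_⟩
    rw [ip_div_sqrt, hz]
    push_cast
    field_simp
  · intro v hv
    have hint (i : ι) : ∃ z : ℤ, v i * Real.sqrt m = z := by
      simpa [ip, Pi.single_apply] using hv _ (single_sqrt_mem_constructionALattice C i)
    choose z hz using hint
    have hvz : v = fun i => (z i : ℝ) / Real.sqrt m := by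
      ext i
      rw [← hz, mul_div_cancel_right₀ _ hm]
    refine ⟨z, (hmem _).2 fun c hc => ?_, hvz⟩
    have hlift : (fun i => (((c i).valMinAbs : ℤ) : ZMod m)) = c := by simp
    obtain ⟨t, ht⟩ := hv _ ⟨fun i => (c i).valMinAbs, by rw [hlift]; exact hc, rfl⟩
    rw [hvz, ip_div_sqrt, div_eq_iff hm0] at ht
    have ht' : ∑ i, z i * (c i).valMinAbs = t * m := by exact_mod_cast ht
    simpa using congrArg (Int.cast : ℤ → ZMod m) ht'

theorem natAbs_valMinAbs_sq [NeZero m] (a : ZMod m) :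
    a.valMinAbs.natAbs ^ 2 = min (a.val ^ 2) ((m - a.val) ^ 2) := by
  rw [ZMod.valMinAbs_natAbs_eq_min]
  exact (Nat.pow_left_strictMono two_ne_zero).monotone.map_min

theorem euclWt_eq_sum_valMinAbs [NeZero m] (c : ι → ZMod m) :
    (euclWt c : ℤ) = ∑ i, (c i).valMinAbs * (c i).valMinAbs := by
  simp_rw [euclWt, ← natAbs_valMinAbs_sq, Nat.cast_sum, Nat.cast_pow, Int.natAbs_sq, sq]

theorem euclWt_le_sum_sq [NeZero m] (x : ι → ℤ) :
    (euclWt (fun i => (x i : ZMod m)) : ℤ) ≤ ∑ i, x i * x i := by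
  rw [euclWt_eq_sum_valMinAbs]
  refine Finset.sum_le_sum fun i _ => ?_
  rw [← Int.natAbs_le_iff_mul_self_le]
  exact ZMod.natAbs_min_of_le_div_two m _ _ (by simp) (ZMod.natAbs_valMinAbs_le _)

theorem two_mul_dvd_sum_sq_sub_euclWt [NeZero m] (hm : 2 ∣ m) (x : ι → ℤ) :
    (2 * m : ℤ) ∣ ∑ i, x i * x i - euclWt (fun i => (x i : ZMod m)) := by
  rw [euclWt_eq_sum_valMinAbs, ← Finset.sum_sub_distrib]
  refine Finset.dvd_sum fun i _ => ?_
  set r := (x i : ZMod m).valMinAbs with hr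
  obtain ⟨t, ht⟩ : (m : ℤ) ∣ x i - r := by
    rw [← ZMod.intCast_zmod_eq_zero_iff_dvd, hr]
    simp
  obtain ⟨k, hk⟩ := hm
  have hk' : (m : ℤ) = 2 * k := by exact_mod_cast hk
  refine ⟨t * (r + k * t), ?_⟩
  linear_combination (x i + r) * ht + (m * t : ℤ) * ht + (m * t ^ 2 : ℤ) * hk'

end Auxiliary

theorem isEvenLattice_constructionALattice {k : ℕ} [NeZero k] {ι : Type*} [Fintype ι]
    {C : Submodule (ZMod (2 * k)) (ι → ZMod (2 * k))} (hC : IsTypeII k C) :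
    IsEvenLattice (constructionALattice C) := by
  rintro _ ⟨x, hx, rfl⟩
  have hk : (k : ℝ) ≠ 0 := Nat.cast_ne_zero.2 (NeZero.ne k)
  have hwt : (2 * (2 * k : ℕ) : ℤ) ∣ euclWt (fun i => (x i : ZMod (2 * k))) := by
    have := Int.natCast_dvd_natCast.2 (hC.2 _ hx)
    push_cast at this ⊢
    rwa [← mul_assoc]
  obtain ⟨z, hz⟩ := (dvd_sub_left hwt).1
    (two_mul_dvd_sum_sq_sub_euclWt (Dvd.intro _ rfl) x)
  refine ⟨z, ?_⟩
  rw [ip_div_sqrt, hz]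
  push_cast
  field_simp

/-- The minimum norm of a Construction A lattice is `minEuclWt C / m` once this is at most `m`. -/
theorem hasMinNorm_constructionALattice {m : ℕ} [NeZero m] {ι : Type*} [Fintype ι]
    {C : Submodule (ZMod m) (ι → ZMod m)} (hpos : 0 < minEuclWt C)
    (hle : minEuclWt C ≤ m * m) :
    HasMinNorm (constructionALattice C) ((minEuclWt C : ℝ) / m) := by
  constructor
  · obtain ⟨c, hc, hc0, hwt⟩ := Nat.sInf_mem (Nat.nonempty_of_pos_sInf hpos)
    have hlift : (fun i => (((c i).valMinAbs : ℤ) : ZMod m)) = c := by simp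
    have hm : Real.sqrt m ≠ 0 := (Real.sqrt_pos.2 (Nat.cast_pos.2 (NeZero.pos m))).ne'
    refine ⟨_, ⟨fun i => (c i).valMinAbs, by rw [hlift]; exact hc, rfl⟩, fun h => hc0 ?_, ?_⟩
    · ext i
      simpa [hm] using congrFun h i
    · rw [ip_div_sqrt, ← euclWt_eq_sum_valMinAbs, hwt, Int.cast_natCast]
      rfl
  · rintro _ ⟨_, ⟨x, hx, rfl⟩, hne, rfl⟩
    rw [ip_div_sqrt]
    gcongr
    suffices h : (minEuclWt C : ℤ) ≤ ∑ i, x i * x i by exact_mod_cast h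
    by_cases h0 : (fun i => (x i : ZMod m)) = 0
    · obtain ⟨i, hi⟩ : ∃ i, x i ≠ 0 := by
        by_contra! h
        exact hne (by ext; simp [h])
      have hdvd : (m : ℤ) ∣ x i := (ZMod.intCast_zmod_eq_zero_iff_dvd _ _).1 (congrFun h0 i)
      calc (minEuclWt C : ℤ) ≤ m * m := by exact_mod_cast hle
        _ ≤ x i * x i := by
          rw [← Int.natAbs_le_iff_mul_self_le]
          exact Int.natAbs_le_of_dvd_ne_zero hdvd hi
        _ ≤ ∑ i, x i * x i :=
          Finset.single_le_sum (f := fun i => x i * x i)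
            (fun j _ => mul_self_nonneg (x j)) (Finset.mem_univ i)
    · have hmin : minEuclWt C ≤ euclWt fun i => (x i : ZMod m) := Nat.sInf_le ⟨_, hx, h0, rfl⟩
      exact (Int.ofNat_le.2 hmin).trans (euclWt_le_sum_sq x)

/-- Construction A applied to an extremal Type II ℤ_{2k}-code of length 72
(k = 4, 5, 6) gives a 72-dimensional extremal even unimodular lattice. -/
theorem constructionA_extremal_72 (k : ℕ) (hk : k ∈ ({4, 5, 6} : Set ℕ))
    (C : Submodule (ZMod (2 * k)) (Fin 72 → ZMod (2 * k)))
    (hC : IsTypeII k C) (hd : minEuclWt C = 16 * k) :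
    ∃ L : Submodule ℤ (Fin 72 → ℝ),
      (L : Set (Fin 72 → ℝ)) = constructionA (2 * k) (C : Set (Fin 72 → ZMod (2 * k))) ∧
      IsLatticeIn L ∧ IsUnimodularLattice L ∧ IsEvenLattice L ∧ HasMinNorm L 8 := by
  have hk4 : 4 ≤ k := by
    rcases hk with rfl | rfl | rfl <;> norm_num
  have : NeZero k := ⟨by omega⟩
  refine ⟨constructionALattice C, rfl, isLatticeIn_constructionALattice C,
    isUnimodularLattice_constructionALattice hC.1, isEvenLattice_constructionALattice hC, ?_⟩
  have hmin := hasMinNorm_constructionALattice (C := C) (by omega) (by rw [hd]; nlinarith)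
  have hk0 : (k : ℝ) ≠ 0 := Nat.cast_ne_zero.2 (by omega)
  convert hmin using 1
  rw [hd]
  push_cast
  field_simp
  norm_num
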